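/- Let H be a complex Hilbert space, let φ : B(H) → B(H) be a positive linear map which is power bounded (i.e., sup_{k∈ℕ} ‖φ^k‖ < ∞), let D ∈ B(H) be self-adjoint, and let m ≥ 1. Then (id − φ)^m(D) ≥ 0 if and only if (id − φ)^s(D) ≥ 0 for every s = 1, …, m. -/

import Mathlib

open Filter

section PositiveMap

variable {H : Type} [NormedAddCommGroup H] [InnerProductSpace ℂ H] [CompleteSpace H]

/-- A positive linear map on `B(H)` preserves self-adjointness. -/
theorem isSelfAdjoint_map_of_isPositive_map
    (φ : (H →L[ℂ] H) →ₗ[ℂ] (H →L[ℂ] H))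
    (hpos : ∀ X : H →L[ℂ] H, X.IsPositive → (φ X).IsPositive)
    {X : H →L[ℂ] H} (hX : IsSelfAdjoint X) : IsSelfAdjoint (φ X) := by
  have h1 : (0 : H →L[ℂ] H) ≤ X⁺ := CFC.posPart_nonneg X
  have h2 : (0 : H →L[ℂ] H) ≤ X⁻ := CFC.negPart_nonneg X
  rw [ContinuousLinearMap.nonneg_iff_isPositive] at h1 h2
  rw [← CFC.posPart_sub_negPart X hX, map_sub]
  exact (hpos _ h1).isSelfAdjoint.sub (hpos _ h2).isSelfAdjoint

/-- The iterates of `id - φ` preserve self-adjointness when `φ` is positive. -/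
theorem isSelfAdjoint_iterate_sub_map
    (φ : (H →L[ℂ] H) →ₗ[ℂ] (H →L[ℂ] H))
    (hpos : ∀ X : H →L[ℂ] H, X.IsPositive → (φ X).IsPositive)
    {D : H →L[ℂ] H} (hD : IsSelfAdjoint D) (s : ℕ) :
    IsSelfAdjoint ((fun X : H →L[ℂ] H => X - φ X)^[s] D) := by
  induction s with
  | zero => exact hD
  | succ s ih =>
    rw [Function.iterate_succ_apply']
    exact ih.sub (isSelfAdjoint_map_of_isPositive_map φ hpos ih)

/-- If `φ` is positive and power bounded, `φ B ≤ B` and `B = Y - φ Y` is self-adjoint,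
then `B` is positive. -/
theorem isPositive_sub_map_of_isPositive_sub_map_sub_map
    (φ : (H →L[ℂ] H) →ₗ[ℂ] (H →L[ℂ] H))
    (hpos : ∀ X : H →L[ℂ] H, X.IsPositive → (φ X).IsPositive)
    (hpb : ∃ M : ℝ, ∀ (k : ℕ) (X : H →L[ℂ] H), ‖(⇑φ)^[k] X‖ ≤ M * ‖X‖)
    {Y : H →L[ℂ] H} (hsa : IsSelfAdjoint (Y - φ Y))
    (hB : ((Y - φ Y) - φ (Y - φ Y)).IsPositive) : (Y - φ Y).IsPositive := by
  obtain ⟨M, hM⟩ := hpb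
  have hstep : ∀ k : ℕ, ((⇑φ)^[k] (Y - φ Y) - (⇑φ)^[k + 1] (Y - φ Y)).IsPositive := by
    intro k
    induction k with
    | zero => exact hB
    | succ k ih =>
      have h := hpos _ ih
      rwa [map_sub, ← Function.iterate_succ_apply' (⇑φ), ← Function.iterate_succ_apply' (⇑φ)] at h
  have hiter : ∀ k : ℕ, (⇑φ)^[k] (Y - φ Y) = (⇑φ)^[k] Y - (⇑φ)^[k + 1] Y := by
    intro k
    rw [Function.iterate_succ_apply, iterate_map_sub]
  refine ContinuousLinearMap.isPositive_def'.2 ⟨hsa, fun x => ?_⟩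
  have hre_sub : ∀ S T : H →L[ℂ] H,
      (S - T).reApplyInnerSelf x = S.reApplyInnerSelf x - T.reApplyInnerSelf x := by
    intro S T
    simp [ContinuousLinearMap.reApplyInnerSelf_apply, inner_sub_left]
  have hle : ∀ k : ℕ, ((⇑φ)^[k] (Y - φ Y)).reApplyInnerSelf x
      ≤ (Y - φ Y).reApplyInnerSelf x := by
    intro k
    induction k with
    | zero => exact le_rfl
    | succ k ih =>
      have h := (ContinuousLinearMap.isPositive_def'.1 (hstep k)).2 x
      rw [hre_sub] at h
      linarith
  have hsum : ∀ k : ℕ, Y.reApplyInnerSelf x - ((⇑φ)^[k] Y).reApplyInnerSelf x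
      ≤ k * (Y - φ Y).reApplyInnerSelf x := by
    intro k
    induction k with
    | zero => simp
    | succ k ih =>
      have h := hle k
      rw [hiter, hre_sub] at h
      push_cast
      linarith
  have hbound : ∀ k : ℕ, ((⇑φ)^[k] Y).reApplyInnerSelf x ≤ M * ‖Y‖ * ‖x‖ * ‖x‖ := by
    intro k
    calc ((⇑φ)^[k] Y).reApplyInnerSelf x ≤ ‖(⇑φ)^[k] Y x‖ * ‖x‖ := re_inner_le_norm _ _
      _ ≤ M * ‖Y‖ * ‖x‖ * ‖x‖ := by
        gcongr
        exact ((⇑φ)^[k] Y).le_of_opNorm_le (hM k Y) x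
  by_contra! hneg
  obtain ⟨n, hn⟩ := exists_nat_gt
    ((M * ‖Y‖ * ‖x‖ * ‖x‖ - Y.reApplyInnerSelf x) / -(Y - φ Y).reApplyInnerSelf x)
  rw [div_lt_iff₀ (by linarith)] at hn
  linarith [hsum n, hbound n]

end PositiveMap

/-- Let `φ : B(H) → B(H)` be a positive linear map which is power bounded and
let `D ∈ B(H)` be self-adjoint.  For `m ≥ 1`, `(id − φ)^m (D) ≥ 0` if and only if
`(id − φ)^s (D) ≥ 0` for every `s = 1, …, m`. -/
theorem statement0 {H : Type} [NormedAddCommGroup H] [InnerProductSpace ℂ H] [CompleteSpace H]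
    (φ : (H →L[ℂ] H) →ₗ[ℂ] (H →L[ℂ] H))
    (hpos : ∀ X : H →L[ℂ] H, X.IsPositive → (φ X).IsPositive)
    (hpb : ∃ M : ℝ, ∀ (k : ℕ) (X : H →L[ℂ] H), ‖(⇑φ)^[k] X‖ ≤ M * ‖X‖)
    (D : H →L[ℂ] H) (hD : IsSelfAdjoint D) (m : ℕ) (hm : 1 ≤ m) :
    ((fun X : H →L[ℂ] H => X - φ X)^[m] D).IsPositive ↔
      ∀ s : ℕ, 1 ≤ s → s ≤ m → ((fun X : H →L[ℂ] H => X - φ X)^[s] D).IsPositive := by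
  refine ⟨fun h s hs hsm => ?_, fun h => h m hm le_rfl⟩
  induction hsm using Nat.decreasingInduction with
  | self => exact h
  | of_succ s _ ih =>
    obtain ⟨t, rfl⟩ := Nat.exists_eq_add_of_le' hs
    have hnext := ih (by omega)
    have hsa := isSelfAdjoint_iterate_sub_map φ hpos hD (t + 1)
    simp only [Function.iterate_succ_apply'] at hnext hsa ⊢
    exact isPositive_sub_map_of_isPositive_sub_map_sub_map φ hpos hpb hsa hnext
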